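/- arXiv:1607.04090 — 10 statements merged into one kernel-verified Lean document; each statement's English description precedes it below -/
import Mathlib

section
/- Let ⟨K,R,⊨⟩ be a Kripke model such that for every k ∈ K the restriction of R to R⁺[k] is reflexive (xRx for all x ∈ R⁺[k]) and ⊨ is formula persistent on R⁺[k] (for all x,y ∈ R⁺[k] with xRy and every formula φ, x ⊨ φ implies y ⊨ φ). Then every instance of axiom (A₄), i.e., every formula of the form (φ&[φ→ψ])→(ψ&[ψ→φ]), is satisfied at every node of the model. -/
/-- Formulas of propositional fuzzy logic: falsity, atoms (indexed by ℕ),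
conjunction `&` and implication `→`. -/
inductive FuzzyFormula : Type where
  | bot  : FuzzyFormula
  | atom : ℕ → FuzzyFormula
  | conj : FuzzyFormula → FuzzyFormula → FuzzyFormula
  | impl : FuzzyFormula → FuzzyFormula → FuzzyFormula

/-- Kripke satisfaction for a model `⟨K, R, V⟩`:
`V` is the satisfaction relation on atoms, extended to all formulas. -/
def Sat {K : Type*} (R : K → K → Prop) (V : K → ℕ → Prop) : K → FuzzyFormula → Prop
  | _, .bot => False
  | k, .atom p => V k p
  | k, .conj φ ψ => Sat R V k φ ∧ Sat R V k ψ
  | k, .impl φ ψ => ∀ k', R k k' → Sat R V k' φ → Sat R V k' ψ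

/-- `x ∈ R⁺[k]`: `x` is reachable from `k` in `n ≥ 1` `R`-steps. -/
def RPlus {K : Type*} (R : K → K → Prop) (k x : K) : Prop :=
  Relation.TransGen R k x

/-- `x ∈ R⁺⁺[k]`: `x` is reachable from `k` in `n ≥ 2` `R`-steps. -/
def RPlusPlus {K : Type*} (R : K → K → Prop) (k x : K) : Prop :=
  ∃ y, R k y ∧ Relation.TransGen R y x

/-- `x ∈ R²[k]`: `x` is reachable from `k` in exactly two `R`-steps. -/
def RSq {K : Type*} (R : K → K → Prop) (k x : K) : Prop :=
  ∃ y, R k y ∧ R y x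

/-- If in a Kripke model, for every `k`, the restriction of `R`
to `R⁺[k]` is reflexive and the satisfaction relation is formula persistent
on `R⁺[k]`, then every instance of axiom (A₄),
`(φ & [φ→ψ]) → (ψ & [ψ→φ])`, holds at every node. -/
theorem stmt8 {K : Type*} (R : K → K → Prop) (V : K → ℕ → Prop)
    (hrefl : ∀ k : K, ∀ x, RPlus R k x → R x x)
    (hper : ∀ k : K, ∀ x y, RPlus R k x → RPlus R k y → R x y →
      ∀ φ : FuzzyFormula, Sat R V x φ → Sat R V y φ) :
    ∀ k : K, ∀ φ ψ : FuzzyFormula,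
      Sat R V k (.impl (.conj φ (.impl φ ψ)) (.conj ψ (.impl ψ φ))) := by
  intro k φ ψ x hkx
  simp only [Sat]
  rintro ⟨hφ, hφψ⟩
  have hx : RPlus R k x := .single hkx
  exact ⟨hφψ x (hrefl k x hx) hφ,
    fun y hxy _ => hper k x y hx (hx.tail hxy) hxy φ hφ⟩
end

section
/- If a Kripke frame ⟨K,R⟩ satisfies axiom (A₄), i.e., for every Kripke model on ⟨K,R⟩ every formula of the form (φ&[φ→ψ])→(ψ&[ψ→φ]) holds at every node, then for every k ∈ K the restriction of R to R⁺[k] is reflexive: xRx for all x ∈ R⁺[k]. -/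
/-- If a Kripke frame satisfies axiom (A₄),
`(φ & [φ→ψ]) → (ψ & [ψ→φ])`, in every model on the frame, then for every `k`
the restriction of `R` to `R⁺[k]` is reflexive. -/
theorem stmt9 {K : Type*} (R : K → K → Prop)
    (hA4 : ∀ V : K → ℕ → Prop, ∀ k : K, ∀ φ ψ : FuzzyFormula,
      Sat R V k (.impl (.conj φ (.impl φ ψ)) (.conj ψ (.impl ψ φ)))) :
    ∀ k : K, ∀ x, RPlus R k x → R x x := by
  intro k x hx
  obtain ⟨y, hy⟩ : ∃ y, R y x := by
    cases hx with
    | single h => exact ⟨_, h⟩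
    | tail _ h => exact ⟨_, h⟩
  let V : K → ℕ → Prop := fun z n => if n = 0 then z = x else R x z
  have h := hA4 V y (.atom 0) (.atom 1) x hy
  simp only [Sat, V, if_true, one_ne_zero, if_false] at h
  exact (h ⟨trivial, fun _ hz _ => hz⟩).1
end

section
/- If a Kripke model ⟨K,R,⊨⟩ satisfies every instance of axiom (A₄), i.e., every formula of the form (φ&[φ→ψ])→(ψ&[ψ→φ]) holds at every node, then for every k ∈ K the satisfaction relation ⊨ is formula persistent on R⁺[k]: for all x,y ∈ R⁺[k] with xRy and every formula φ, x ⊨ φ implies y ⊨ φ. -/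
/-- If a Kripke model satisfies every instance of axiom (A₄),
`(φ & [φ→ψ]) → (ψ & [ψ→φ])`, at every node, then for every `k` the
satisfaction relation is formula persistent on `R⁺[k]`. -/
theorem stmt10 {K : Type*} (R : K → K → Prop) (V : K → ℕ → Prop)
    (hA4 : ∀ k : K, ∀ φ ψ : FuzzyFormula,
      Sat R V k (.impl (.conj φ (.impl φ ψ)) (.conj ψ (.impl ψ φ)))) :
    ∀ k : K, ∀ x y, RPlus R k x → RPlus R k y → R x y →
      ∀ φ : FuzzyFormula, Sat R V x φ → Sat R V y φ := by
  intro k x y hx _ hxy φ hφ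
  obtain ⟨p, -, hpx⟩ := Relation.TransGen.tail'_iff.mp hx
  have hA := hA4 p φ (.impl .bot .bot)
  simp only [Sat] at hA
  exact (hA x hpx ⟨hφ, fun _ _ _ _ _ h => h⟩).2 y hxy fun _ _ h => h
end

section
/- A Kripke frame ⟨K,R⟩ satisfies axiom (A₅a), i.e., for every Kripke model on ⟨K,R⟩ every formula of the form [φ→(ψ→θ)]→[(φ&ψ)→θ] holds at every node, if and only if for every k ∈ K the restriction of R to R²[k] is reflexive: xRx for every x ∈ R²[k]. -/
/-- A Kripke frame satisfies axiom (A₅a),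
`[φ→(ψ→θ)] → [(φ&ψ)→θ]`, in every model on the frame, if and only if for
every `k` the restriction of `R` to `R²[k]` is reflexive. -/
theorem stmt11 {K : Type*} (R : K → K → Prop) :
    (∀ V : K → ℕ → Prop, ∀ k : K, ∀ φ ψ θ : FuzzyFormula,
      Sat R V k (.impl (.impl φ (.impl ψ θ)) (.impl (.conj φ ψ) θ)))
    ↔ (∀ k : K, ∀ x, RSq R k x → R x x) := by
  constructor
  · rintro h k x ⟨y, hky, hyx⟩
    by_contra hxx
    refine h (fun z _ => z = x) k (.atom 0) (.atom 0) .bot y hky ?_ x hyx ⟨rfl, rfl⟩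
    rintro z - rfl w hzw rfl
    exact hxx hzw
  · intro h V k φ ψ θ y hky hy x hyx hx
    exact hy x hyx hx.1 x (h k x ⟨y, hky, hyx⟩) hx.2
end

section
/- Let ⟨K,R,⊨⟩ be a Kripke model such that for every k ∈ K the restriction of R to R⁺[k] is transitive (for all x,y,z ∈ R⁺[k], xRy and yRz imply xRz) and ⊨ is formula persistent on R⁺⁺[k] (for all x,y ∈ R⁺⁺[k] with xRy and every formula φ, x ⊨ φ implies y ⊨ φ). Then every instance of axiom (A₅b), i.e., every formula of the form [(φ&ψ)→θ]→[φ→(ψ→θ)], is satisfied at every node of the model. -/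
/-- If in a Kripke model, for every `k`, the restriction of `R`
to `R⁺[k]` is transitive and the satisfaction relation is formula persistent
on `R⁺⁺[k]`, then every instance of axiom (A₅b), `[(φ&ψ)→θ] → [φ→(ψ→θ)]`,
holds at every node. -/
theorem stmt12 {K : Type*} (R : K → K → Prop) (V : K → ℕ → Prop)
    (htrans : ∀ k : K, ∀ x y z, RPlus R k x → RPlus R k y → RPlus R k z →
      R x y → R y z → R x z)
    (hper : ∀ k : K, ∀ x y, RPlusPlus R k x → RPlusPlus R k y → R x y →
      ∀ φ : FuzzyFormula, Sat R V x φ → Sat R V y φ) :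
    ∀ k : K, ∀ φ ψ θ : FuzzyFormula,
      Sat R V k (.impl (.impl (.conj φ ψ) θ) (.impl φ (.impl ψ θ))) := by
  intro k φ ψ θ a hka hθ b hab hφ c hbc hψ
  have hkb : RPlusPlus R k b := ⟨a, hka, .single hab⟩
  have hkc : RPlusPlus R k c := ⟨a, hka, .tail (.single hab) hbc⟩
  have hac : R a c :=
    htrans k a b c (.single hka) (.tail (.single hka) hab)
      (.tail (.tail (.single hka) hab) hbc) hab hbc
  exact hθ c hac ⟨hper k b c hkb hkc hbc φ hφ, hψ⟩
end

section
/- If a Kripke frame ⟨K,R⟩ satisfies axiom (A₅b), i.e., for every Kripke model on ⟨K,R⟩ every formula of the form [(φ&ψ)→θ]→[φ→(ψ→θ)] holds at every node, then for every k ∈ K the restriction of R to R⁺[k] is transitive: for all x,y,z ∈ R⁺[k], xRy and yRz imply xRz. -/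
/-- If a Kripke frame satisfies axiom (A₅b),
`[(φ&ψ)→θ] → [φ→(ψ→θ)]`, in every model on the frame, then for every `k` the
restriction of `R` to `R⁺[k]` is transitive. -/
theorem stmt13 {K : Type*} (R : K → K → Prop)
    (hA5b : ∀ V : K → ℕ → Prop, ∀ k : K, ∀ φ ψ θ : FuzzyFormula,
      Sat R V k (.impl (.impl (.conj φ ψ) θ) (.impl φ (.impl ψ θ)))) :
    ∀ k : K, ∀ x y z, RPlus R k x → RPlus R k y → RPlus R k z →
      R x y → R y z → R x z := by
  intro k x y z hx _ _ hxy hyz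
  obtain ⟨w, -, hwx⟩ := (Relation.TransGen.tail'_iff).1 hx
  have h := hA5b (fun n p => p = 0 ∨ R x n) w (.atom 0) (.atom 0) (.atom 1) x hwx
    (fun n hn _ => Or.inr hn) y hxy (Or.inl rfl) z hyz (Or.inl rfl)
  exact h.resolve_left one_ne_zero
end

section
/- If a Kripke model ⟨K,R,⊨⟩ satisfies every instance of axiom (A₅b), i.e., every formula of the form [(φ&ψ)→θ]→[φ→(ψ→θ)] holds at every node, then for every k ∈ K the satisfaction relation ⊨ is formula persistent on R⁺⁺[k]: for all x,y ∈ R⁺⁺[k] with xRy and every formula φ, x ⊨ φ implies y ⊨ φ. -/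
/-- A node reachable in at least two steps is the endpoint of a path of length exactly two. -/
theorem RPlusPlus.exists_rSq {K : Type*} {R : K → K → Prop} {k x : K} (h : RPlusPlus R k x) :
    ∃ v, RSq R v x := by
  obtain ⟨v, hkv, hvx⟩ := h
  obtain ⟨w, hvw, hwx⟩ := Relation.TransGen.tail'_iff.mp hvx
  rcases Relation.ReflTransGen.cases_tail hvw with rfl | ⟨u, -, huw⟩
  · exact ⟨k, w, hkv, hwx⟩
  · exact ⟨u, w, huw, hwx⟩

/-- If a Kripke model satisfies every instance of axiom (A₅b),
`[(φ&ψ)→θ] → [φ→(ψ→θ)]`, at every node, then for every `k` the satisfaction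
relation is formula persistent on `R⁺⁺[k]`. -/
theorem stmt14 {K : Type*} (R : K → K → Prop) (V : K → ℕ → Prop)
    (hA5b : ∀ k : K, ∀ φ ψ θ : FuzzyFormula,
      Sat R V k (.impl (.impl (.conj φ ψ) θ) (.impl φ (.impl ψ θ)))) :
    ∀ k : K, ∀ x y, RPlusPlus R k x → RPlusPlus R k y → R x y →
      ∀ φ : FuzzyFormula, Sat R V x φ → Sat R V y φ := by
  intro k x y hx _ hxy φ hφ
  obtain ⟨v, w, hvw, hwx⟩ := hx.exists_rSq
  let top : FuzzyFormula := .impl .bot .bot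
  exact (hA5b v φ top (.conj φ top) w hvw (fun _ _ h => h) x hwx hφ y hxy (fun _ _ h => h)).1
end

section
/- Let ⟨K,R,⊨⟩ be a Kripke model in which R is connected (for every k ∈ K and all k',k'' ∈ R⁺[k], either k'Rk'' or k''Rk') and ⊨ is formula persistent (for all k,k' ∈ K with kRk' and every formula φ, k ⊨ φ implies k' ⊨ φ). Then every instance of axiom (A₆), i.e., every formula of the form [(φ→ψ)→θ]→[([ψ→φ]→θ)→θ], is satisfied at every node of the model. -/
/-- In a connected Kripke model whose satisfaction relation is
formula persistent, every instance of axiom (A₆),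
`[(φ→ψ)→θ] → [([ψ→φ]→θ) → θ]`, holds at every node. -/
theorem stmt16 {K : Type*} (R : K → K → Prop) (V : K → ℕ → Prop)
    (hconn : ∀ k k' k'' : K, RPlus R k k' → RPlus R k k'' →
      R k' k'' ∨ R k'' k')
    (hper : ∀ k k' : K, R k k' →
      ∀ φ : FuzzyFormula, Sat R V k φ → Sat R V k' φ) :
    ∀ k : K, ∀ φ ψ θ : FuzzyFormula,
      Sat R V k (.impl (.impl (.impl φ ψ) θ)
        (.impl (.impl (.impl ψ φ) θ) θ)) := by
  intro k φ ψ θ k₁ hk₁ h₁ k₂ hk₂ h₂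
  have reach₂ : RPlus R k k₂ := (Relation.TransGen.single hk₁).tail hk₂
  have hrefl : R k₂ k₂ := (hconn k k₂ k₂ reach₂ reach₂).elim id id
  by_cases hφψ : Sat R V k₂ (.impl φ ψ)
  · exact h₁ k₂ hk₂ hφψ
  · refine h₂ k₂ hrefl fun b hb hbψ => ?_
    by_contra hbφ
    refine hφψ fun a ha haφ => ?_
    rcases hconn k a b (reach₂.tail ha) (reach₂.tail hb) with hab | hba
    · exact absurd (hper a b hab φ haφ) hbφ
    · exact hper b a hba ψ hbψ
end

section
/- Let ⟨K,R⟩ be a Kripke frame with R reflexive and transitive such that every Kripke model on ⟨K,R⟩ whose satisfaction relation is formula persistent (for all k,k' ∈ K with kRk' and every formula φ, k ⊨ φ implies k' ⊨ φ) satisfies every instance of axiom (A₆), i.e., every formula of the form [(φ→ψ)→θ]→[([ψ→φ]→θ)→θ] holds at every node. Then R is connected: for every k ∈ K and all k',k'' ∈ R⁺[k], either k'Rk'' or k''Rk'. -/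
theorem Sat.persistent {K : Type*} {R : K → K → Prop} {V : K → ℕ → Prop}
    (htrans : ∀ x y z, R x y → R y z → R x z)
    (hV : ∀ k k' p, R k k' → V k p → V k' p) {k k' : K} (hk : R k k') (φ : FuzzyFormula) :
    Sat R V k φ → Sat R V k' φ := by
  induction φ with
  | bot => exact id
  | atom p => exact hV k k' p hk
  | conj φ ψ ihφ ihψ => exact And.imp ihφ ihψ
  | impl φ ψ _ _ => exact fun h x hx => h x (htrans _ _ _ hk hx)

/-- The valuation making atom `0` true above `a`, atom `1` true above `b`, and every other atom
true exactly where one of the implications between these two atoms holds. -/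
def separatingValuation {K : Type*} (R : K → K → Prop) (a b x : K) : ℕ → Prop
  | 0 => R a x
  | 1 => R b x
  | _ => (∀ y, R x y → R a y → R b y) ∨ (∀ y, R x y → R b y → R a y)

theorem separatingValuation_persistent {K : Type*} {R : K → K → Prop}
    (htrans : ∀ x y z, R x y → R y z → R x z) (a b x y : K) (p : ℕ) (hxy : R x y) :
    separatingValuation R a b x p → separatingValuation R a b y p :=
  match p with
  | 0 => fun h => htrans _ _ _ h hxy
  | 1 => fun h => htrans _ _ _ h hxy
  | _ + 2 => Or.imp (fun h z hz => h z (htrans _ _ _ hxy hz))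
      (fun h z hz => h z (htrans _ _ _ hxy hz))

/-- If `R` is reflexive and transitive and every Kripke model
on the frame with a formula-persistent satisfaction relation satisfies every
instance of axiom (A₆), `[(φ→ψ)→θ] → [([ψ→φ]→θ) → θ]`, at every node, then
`R` is connected. -/
theorem stmt17 {K : Type*} (R : K → K → Prop)
    (hrefl : ∀ k, R k k)
    (htrans : ∀ x y z, R x y → R y z → R x z)
    (hA6 : ∀ V : K → ℕ → Prop,
      (∀ k k' : K, R k k' →
        ∀ φ : FuzzyFormula, Sat R V k φ → Sat R V k' φ) →
      ∀ k : K, ∀ φ ψ θ : FuzzyFormula,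
        Sat R V k (.impl (.impl (.impl φ ψ) θ)
          (.impl (.impl (.impl ψ φ) θ) θ))) :
    ∀ k k' k'' : K, RPlus R k k' → RPlus R k k'' → R k' k'' ∨ R k'' k' := by
  intro k a b ha hb
  have trans : IsTrans K R := ⟨htrans⟩
  have ha : R k a := Relation.transGen_eq_self (r := R) ▸ ha
  have hb : R k b := Relation.transGen_eq_self (r := R) ▸ hb
  have h : separatingValuation R a b k 2 :=
    hA6 (separatingValuation R a b)
      (fun _ _ hxy => Sat.persistent htrans (separatingValuation_persistent htrans a b) hxy)
      k (.atom 0) (.atom 1) (.atom 2)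
      k (hrefl k) (fun _ _ h => Or.inl h) k (hrefl k) (fun _ _ h => Or.inr h)
  rcases h with h | h
  · exact Or.inr (h a ha (hrefl a))
  · exact Or.inl (h b hb (hrefl b))
end

section
/- Let ⟨K,R,⊨⟩ be a Kripke model in which R is reflexive, transitive and connected (for every k ∈ K and all k',k'' ∈ R⁺[k], either k'Rk'' or k''Rk') and ⊨ is formula persistent (for all k,k' ∈ K with kRk' and every formula φ, k ⊨ φ implies k' ⊨ φ). Then the model satisfies all axioms (A₁)–(A₇) of the Basic Fuzzy Logic BL and its rule Modus Ponens: at every node k and for all formulas φ, ψ, θ, the formulas (φ→ψ)→[(ψ→θ)→(φ→θ)], (φ&ψ)→φ, (φ&ψ)→(ψ&φ), (φ&[φ→ψ])→(ψ&[ψ→φ]), [φ→(ψ→θ)]→[(φ&ψ)→θ], [(φ&ψ)→θ]→[φ→(ψ→θ)], [(φ→ψ)→θ]→[([ψ→φ]→θ)→θ], and ⊥⊥→φ all hold, and if k ⊨ φ and k ⊨ φ→ψ then k ⊨ ψ. -/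
/-- Prelinearity of implication at a node whose successors are pairwise comparable. -/
theorem sat_impl_or_sat_impl {K : Type*} {R : K → K → Prop} {V : K → ℕ → Prop} {k : K}
    (hconn : ∀ k' k'', R k k' → R k k'' → R k' k'' ∨ R k'' k')
    (hper : ∀ k k' : K, R k k' → ∀ φ : FuzzyFormula, Sat R V k φ → Sat R V k' φ)
    (φ ψ : FuzzyFormula) :
    Sat R V k (.impl φ ψ) ∨ Sat R V k (.impl ψ φ) := by
  by_contra! h
  obtain ⟨h₁, h₂⟩ := h
  simp only [Sat, not_forall] at h₁ h₂
  obtain ⟨a, ha, haφ, haψ⟩ := h₁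
  obtain ⟨b, hb, hbψ, hbφ⟩ := h₂
  rcases hconn a b ha hb with hab | hba
  · exact hbφ (hper a b hab φ haφ)
  · exact haψ (hper b a hba ψ hbψ)

/-- A reflexive, transitive, connected Kripke model with a
formula-persistent satisfaction relation satisfies all axioms (A₁)–(A₇) of
the Basic Fuzzy Logic BL and its rule Modus Ponens, at every node. -/
theorem stmt18 {K : Type*} (R : K → K → Prop) (V : K → ℕ → Prop)
    (hrefl : ∀ k, R k k)
    (htrans : ∀ x y z, R x y → R y z → R x z)
    (hconn : ∀ k k' k'' : K, RPlus R k k' → RPlus R k k'' →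
      R k' k'' ∨ R k'' k')
    (hper : ∀ k k' : K, R k k' →
      ∀ φ : FuzzyFormula, Sat R V k φ → Sat R V k' φ) :
    ∀ k : K, ∀ φ ψ θ : FuzzyFormula,
      Sat R V k (.impl (.impl φ ψ) (.impl (.impl ψ θ) (.impl φ θ))) ∧
      Sat R V k (.impl (.conj φ ψ) φ) ∧
      Sat R V k (.impl (.conj φ ψ) (.conj ψ φ)) ∧
      Sat R V k (.impl (.conj φ (.impl φ ψ)) (.conj ψ (.impl ψ φ))) ∧
      Sat R V k (.impl (.impl φ (.impl ψ θ)) (.impl (.conj φ ψ) θ)) ∧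
      Sat R V k (.impl (.impl (.conj φ ψ) θ) (.impl φ (.impl ψ θ))) ∧
      Sat R V k (.impl (.impl (.impl φ ψ) θ)
        (.impl (.impl (.impl ψ φ) θ) θ)) ∧
      Sat R V k (.impl .bot φ) ∧
      (Sat R V k φ → Sat R V k (.impl φ ψ) → Sat R V k ψ) := by
  intro k φ ψ θ
  refine ⟨?_, ?_, ?_, ?_, ?_, ?_, ?_, ?_, ?_⟩
  · intro a _ hφψ b hab hψθ c hbc hφ
    exact hψθ c hbc (hφψ c (htrans a b c hab hbc) hφ)
  · exact fun _ _ h => h.1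
  · exact fun _ _ h => ⟨h.2, h.1⟩
  · intro a _ h
    exact ⟨h.2 a (hrefl a) h.1, fun b hab _ => hper a b hab φ h.1⟩
  · intro a _ h b hab hφψ
    exact h b hab hφψ.1 b (hrefl b) hφψ.2
  · intro a _ h b hab hφ c hbc hψ
    exact h c (htrans a b c hab hbc) ⟨hper b c hbc φ hφ, hψ⟩
  · intro a _ h₁ b hab h₂
    rcases sat_impl_or_sat_impl (k := b)
      (fun x y hx hy => hconn b x y (.single hx) (.single hy)) hper φ ψ with h | h
    · exact h₁ b hab h
    · exact h₂ b (hrefl b) h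
  · exact fun _ _ h => h.elim
  · exact fun hφ h => h k (hrefl k) hφ
end
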